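/- Let U be a real random variable with E[|U|] < ∞ and suppose P(U > x) = o(P(Y > x)) for a nonnegative random variable Y with E[Y] < ∞. Then for every μ > E[U] there exists a real random variable Z such that E[U] < E[Z] < μ, P(Z > x) ≥ P(U > x) for all x ∈ ℝ, and P(Z > x) = l̃(x) P(Y > x) for all sufficiently large x > 0, where l̃ is a slowly varying function with l̃(x) → 0 as x → ∞. -/

import Mathlib

open MeasureTheory Filter Set ProbabilityTheory Real

/-- The tail probability `P(X > x)` as a real number. -/
noncomputable def tailP {Ω : Type*} [MeasurableSpace Ω] (μ : Measure Ω) (X : Ω → ℝ) (x : ℝ) : ℝ :=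
  (μ {ω | x < X ω}).toReal

/-- A nonnegative random variable `X` is long-tailed if `P(X > x) > 0` for all `x ≥ 0` and
`P(X > x + y) / P(X > x) → 1` as `x → ∞` for all `y > 0`. -/
def LongTailed {Ω : Type*} [MeasurableSpace Ω] (μ : Measure Ω) (X : Ω → ℝ) : Prop :=
  (∀ x ≥ 0, 0 < tailP μ X x) ∧
  ∀ y > 0, Tendsto (fun x => tailP μ X (x + y) / tailP μ X x) atTop (nhds 1)


/-- A positive function `l` is slowly varying if `l(vx)/l(x) → 1` as `x → ∞` for all `v > 0`. -/
def SlowlyVarying (l : ℝ → ℝ) : Prop :=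
  ∀ v > (0 : ℝ), Tendsto (fun x => l (v * x) / l x) atTop (nhds 1)

lemma exists_seq (r : ℝ → ℝ) (hr : Tendsto r atTop (nhds 0)) :
    ∃ a : ℕ → ℝ, (∀ k : ℕ, (k : ℝ) + 1 ≤ a k) ∧ (∀ k : ℕ, ((k : ℝ) + 1) * a k ≤ a (k + 1)) ∧
      ∀ k : ℕ, ∀ x ≥ a k, r x < 1 / ((k : ℝ) + 2) := by
  have h : ∀ k : ℕ, ∃ b : ℝ, ∀ x ≥ b, r x < 1 / ((k : ℝ) + 2) := fun k =>
    eventually_atTop.1 (hr.eventually (gt_mem_nhds (by positivity)))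
  choose b hb using h
  let a : ℕ → ℝ := fun n => Nat.rec (max 1 (b 0))
    (fun k ak => max (((k : ℝ) + 1) * ak) (max ((k : ℝ) + 2) (b (k + 1)))) n
  have h0 : a 0 = max 1 (b 0) := rfl
  have hs : ∀ k, a (k + 1) = max (((k : ℝ) + 1) * a k) (max ((k : ℝ) + 2) (b (k + 1))) :=
    fun k => rfl
  refine ⟨a, ?_, ?_, ?_⟩
  · intro k
    cases k with
    | zero => rw [h0]; simp
    | succ k =>
      rw [hs]; push_cast
      refine le_trans ?_ (le_trans (le_max_left _ _) (le_max_right _ _))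
      linarith
  · intro k; rw [hs]; exact le_max_left _ _
  · intro k x hx
    apply hb k x
    cases k with
    | zero => rw [h0] at hx; exact le_trans (le_max_right _ _) hx
    | succ k =>
      rw [hs] at hx
      exact le_trans (le_trans (le_max_right _ _) (le_max_right _ _)) hx

/-- Slowly varying function with good properties, which is the tail of a distribution. -/
lemma exists_slow (r : ℝ → ℝ) (hr : Tendsto r atTop (nhds 0)) :
    ∃ l : ℝ → ℝ, SlowlyVarying l ∧ Tendsto l atTop (nhds 0) ∧ (∀ x, 0 < l x) ∧
      (∀ᶠ x in atTop, r x < l x) ∧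
      ∃ V : ℝ → ℝ, Measurable V ∧ (∀ u, 0 ≤ V u) ∧
        ∀ x, volume.restrict (Ioc (0:ℝ) 1) {u | x < V u} = ENNReal.ofReal (l x) := by
  classical
  obtain ⟨a, ha1, ha2, ha3⟩ := exists_seq r hr
  have hmono : Monotone a := monotone_nat_of_le_succ fun k => by
    refine le_trans ?_ (ha2 k)
    have := ha1 k
    have hk : (0:ℝ) ≤ k := k.cast_nonneg
    nlinarith
  have hex : ∀ x : ℝ, ∃ k : ℕ, x < a k := fun x => by
    obtain ⟨k, hk⟩ := exists_nat_gt x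
    exact ⟨k, by have := ha1 k; linarith⟩
  let N : ℝ → ℕ := fun x => Nat.find (hex x)
  have hN : ∀ x k, x < a k ↔ N x ≤ k := by
    intro x k
    refine ⟨fun h => Nat.find_min' _ h, fun h => lt_of_lt_of_le (Nat.find_spec (hex x)) (hmono h)⟩
  have hNmono : Monotone N := fun x y hxy =>
    (hN x _).1 (lt_of_le_of_lt hxy ((hN y (N y)).2 le_rfl))
  have hNtop : Tendsto N atTop atTop := by
    rw [tendsto_atTop]
    intro k
    filter_upwards [eventually_ge_atTop (a k)] with x hx
    by_contra hlt
    exact absurd ((hN x k).2 (by omega)) (not_lt.2 hx)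
  let l : ℝ → ℝ := fun x => 1 / ((N x : ℝ) + 1)
  have hl0 : Tendsto l atTop (nhds 0) := tendsto_one_div_add_atTop_nhds_zero_nat.comp hNtop
  have hlpos : ∀ x, 0 < l x := fun x => by positivity
  have hsv1 : ∀ v ≥ (1:ℝ), Tendsto (fun x => l (v * x) / l x) atTop (nhds 1) := by
    intro v hv
    have hlow : Tendsto (fun x => 1 - l x) atTop (nhds 1) := by
      simpa using hl0.const_sub 1
    refine tendsto_of_tendsto_of_tendsto_of_le_of_le' hlow tendsto_const_nhds ?_ ?_
    · filter_upwards [eventually_ge_atTop 0, hNtop.eventually_ge_atTop ⌈v⌉₊] with x hx hNx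
      have hvN : v ≤ N x := Nat.ceil_le.1 hNx
      have h1 : N (v * x) ≤ N x + 1 := by
        rw [← hN]
        refine lt_of_lt_of_le ?_ (ha2 _)
        have h2 : x < a (N x) := (hN _ _).2 le_rfl
        nlinarith
      have h1' : (N (v * x) : ℝ) ≤ N x + 1 := by exact_mod_cast h1
      simp only [l]
      rw [div_div_eq_mul_div, div_one, one_div_mul_eq_div, le_div_iff₀ (by positivity),
        sub_mul, one_mul, sub_le_iff_le_add, ← sub_le_iff_le_add', one_div_mul_eq_div,
        le_div_iff₀ (by positivity)]
      have : 0 ≤ (N (v*x) : ℝ) := by positivity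
      have hm : (N x : ℝ) ≤ N (v * x) := by
        have := hNmono (show x ≤ v * x by nlinarith)
        exact_mod_cast this
      nlinarith
    · filter_upwards [eventually_ge_atTop 0] with x hx
      have hm : (N x : ℝ) ≤ N (v * x) := by
        have := hNmono (show x ≤ v * x by nlinarith)
        exact_mod_cast this
      rw [div_le_one (hlpos x)]
      simp only [l]
      gcongr
  have hsv : SlowlyVarying l := by
    intro v hv
    rcases le_total 1 v with h | h
    · exact hsv1 v h
    · have h1 := (hsv1 v⁻¹ ((one_le_inv₀ hv).2 h)).inv₀ one_ne_zero
      have h2 : Tendsto (fun x : ℝ => v * x) atTop atTop := tendsto_id.const_mul_atTop hv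
      have h3 := h1.comp h2
      simp only [inv_one] at h3
      refine h3.congr fun x => ?_
      simp [Function.comp, inv_mul_cancel_left₀ hv.ne']
  refine ⟨l, hsv, hl0, hlpos, ?_, fun u => a (⌊1 / u⌋₊ - 1), ?_, ?_, ?_⟩
  · filter_upwards [hNtop.eventually_ge_atTop 1] with x hx
    obtain ⟨k, hk⟩ : ∃ k, N x = k + 1 := ⟨N x - 1, by omega⟩
    have : a k ≤ x := by
      by_contra hlt
      have := (hN x k).1 (not_le.1 hlt)
      omega
    refine (ha3 k x this).trans_le ?_
    simp only [l, hk]; push_cast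
    apply le_of_eq; ring
  · have : Measurable fun u : ℝ => ⌊1 / u⌋₊ := Nat.measurable_floor.comp (measurable_const.div measurable_id)
    exact (measurable_from_nat (f := fun n => a (n - 1))).comp this
  · intro u
    have := ha1 (⌊1 / u⌋₊ - 1)
    exact le_trans (by positivity) this
  · intro x
    have hset : {u | x < a (⌊1 / u⌋₊ - 1)} ∩ Ioc (0:ℝ) 1 = Ioc 0 (l x) := by
      ext u
      simp only [mem_inter_iff, mem_ofPred_eq, mem_Ioc, hN]
      have key : ∀ u : ℝ, 0 < u → u ≤ 1 → (N x ≤ ⌊1 / u⌋₊ - 1 ↔ u ≤ l x) := by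
        intro u h0 h1
        have hf : 1 ≤ ⌊1 / u⌋₊ := Nat.le_floor (by simpa using (one_le_inv₀ h0).2 h1)
        rw [show (N x ≤ ⌊1 / u⌋₊ - 1) ↔ N x + 1 ≤ ⌊1 / u⌋₊ by omega, Nat.le_floor_iff (by positivity)]
        simp only [l]
        push_cast
        exact le_one_div (by positivity) h0
      have hl1 : l x ≤ 1 := by
        simp only [l]
        rw [div_le_one (by positivity)]
        have : (0:ℝ) ≤ N x := by positivity
        linarith
      constructor
      · rintro ⟨h, h0, h1⟩
        exact ⟨h0, (key u h0 h1).1 h⟩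
      · rintro ⟨h0, h1⟩
        exact ⟨(key u h0 (h1.trans hl1)).2 h1, h0, h1.trans hl1⟩
    rw [Measure.restrict_apply' measurableSet_Ioc, hset]
    simp

lemma splice (p q : Measure ℝ) [IsProbabilityMeasure p] [IsProbabilityMeasure q]
    (hp : Integrable (fun z : ℝ => z) p) (hq : Integrable (fun z : ℝ => z) q)
    (hpq : ∀ᶠ x in atTop, p.real (Ioi x) < q.real (Ioi x)) (m : ℝ) (hm : ∫ z, z ∂p < m) :
    ∃ ν : Measure ℝ, IsProbabilityMeasure ν ∧ Integrable (fun z : ℝ => z) ν ∧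
      (∫ z, z ∂p < ∫ z, z ∂ν) ∧ (∫ z, z ∂ν < m) ∧ (∀ x, p.real (Ioi x) ≤ ν.real (Ioi x)) ∧
      ∀ᶠ x in atTop, ν.real (Ioi x) = q.real (Ioi x) := by
  -- limits
  have hmeas : ∀ (p : Measure ℝ) [IsProbabilityMeasure p],
      Tendsto (fun x => p.real (Iic x)) atTop (nhds 1) := by
    intro p _
    have := tendsto_measure_Iic_atTop p
    rw [measure_univ] at this
    exact (ENNReal.tendsto_toReal ENNReal.one_ne_top).comp this
  have hcompl : ∀ (p : Measure ℝ) [IsProbabilityMeasure p] (x : ℝ),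
      p.real (Ioi x) = 1 - p.real (Iic x) := by
    intro p _ x
    rw [← compl_Iic, probReal_compl_eq_one_sub measurableSet_Iic]
  have hmeanlim : ∀ (p : Measure ℝ) [IsProbabilityMeasure p], Integrable (fun z : ℝ => z) p →
      Tendsto (fun x => ∫ z in Iic x, z ∂p) atTop (nhds (∫ z, z ∂p)) := by
    intro p _ hp
    have := tendsto_setIntegral_of_monotone (μ := p) (f := fun z : ℝ => z) (s := fun x : ℝ => Iic x)
      (fun _ => measurableSet_Iic) (fun x y h => Iic_subset_Iic.2 h) hp.integrableOn
    simpa [iUnion_Iic] using this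
  have hspl : ∀ (p : Measure ℝ) [IsProbabilityMeasure p], Integrable (fun z : ℝ => z) p → ∀ x,
      ∫ z in Iic x, z ∂p + ∫ z in Ioi x, z ∂p = ∫ z, z ∂p := by
    intro p _ hp x
    rw [← compl_Iic]
    exact integral_add_compl measurableSet_Iic hp
  let c : ℝ → ℝ := fun x => q.real (Iic x) / p.real (Iic x)
  have hc : Tendsto c atTop (nhds 1) := by
    have h := (hmeas q).div (hmeas p) one_ne_zero
    rw [div_one] at h
    exact h
  have hmean : Tendsto (fun x => c x * ∫ z in Iic x, z ∂p + ∫ z in Ioi x, z ∂q) atTop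
      (nhds (∫ z, z ∂p)) := by
    have h1 := (hc.mul (hmeanlim p hp)).add ((hmeanlim q hq).const_sub (∫ z, z ∂q))
    simp only [one_mul, sub_self, add_zero] at h1
    refine h1.congr fun x => ?_
    rw [← hspl q hq x]; ring
  have hIio : ∀ᶠ x in atTop, 0 < p.real (Iio x) := by
    have h1 : ∀ᶠ x in atTop, 0 < p.real (Iic x) := (hmeas p).eventually (lt_mem_nhds one_pos)
    obtain ⟨x0, h0⟩ := h1.exists
    filter_upwards [eventually_gt_atTop x0] with x hx
    exact h0.trans_le (measureReal_mono (fun z hz => lt_of_le_of_lt hz hx))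
  obtain ⟨T, hT⟩ := eventually_atTop.1 hpq
  obtain ⟨x1, hx1T, hx1m, hx1⟩ := ((eventually_ge_atTop T).and
    ((hmean.eventually (gt_mem_nhds hm)).and hIio)).exists
  have hpI : 0 < p.real (Iic x1) := hx1.trans_le (measureReal_mono Iio_subset_Iic_self)
  have hc0 : 0 ≤ c x1 := by positivity
  have hcp : c x1 * p.real (Iic x1) = q.real (Iic x1) := div_mul_cancel₀ _ hpI.ne'
  have hc1 : c x1 < 1 := by
    have := hT x1 hx1T
    rw [hcompl p, hcompl q] at this
    rw [div_lt_one hpI]; linarith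
  let ν : Measure ℝ := ENNReal.ofReal (c x1) • p.restrict (Iic x1) + q.restrict (Ioi x1)
  have hνreal : ∀ s, MeasurableSet s →
      ν.real s = c x1 * p.real (s ∩ Iic x1) + q.real (s ∩ Ioi x1) := by
    intro s hs
    simp only [ν]
    have hf : (ENNReal.ofReal (c x1) • p.restrict (Iic x1)) s ≠ ⊤ := by
      rw [Measure.smul_apply, smul_eq_mul]
      exact (ENNReal.mul_lt_top ENNReal.ofReal_lt_top (measure_lt_top _ _)).ne
    rw [measureReal_add_apply hf, measureReal_ennreal_smul_apply, ENNReal.toReal_ofReal hc0,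
      measureReal_restrict_apply hs, measureReal_restrict_apply hs]
  have hνfin : IsFiniteMeasure ν := by
    refine ⟨?_⟩
    simp only [ν, Measure.add_apply, Measure.smul_apply, smul_eq_mul]
    exact ENNReal.add_lt_top.2 ⟨ENNReal.mul_lt_top ENNReal.ofReal_lt_top (measure_lt_top _ _),
      measure_lt_top _ _⟩
  have hνprob : IsProbabilityMeasure ν := by
    have h := hνreal univ MeasurableSet.univ
    rw [univ_inter, univ_inter, hcp, hcompl q] at h
    rw [isProbabilityMeasure_iff_real]
    linarith
  have hνint : Integrable (fun z : ℝ => z) ν :=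
    (hp.integrableOn.smul_measure ENNReal.ofReal_ne_top).add_measure hq.integrableOn
  have hνE : ∫ z, z ∂ν = c x1 * ∫ z in Iic x1, z ∂p + ∫ z in Ioi x1, z ∂q := by
    simp only [ν]
    rw [integral_add_measure (hp.integrableOn.smul_measure ENNReal.ofReal_ne_top) hq.integrableOn,
      integral_smul_measure, ENNReal.toReal_ofReal hc0, smul_eq_mul]
  have hge : ∀ x ≥ x1, ν.real (Ioi x) = q.real (Ioi x) := by
    intro x hx
    rw [hνreal _ measurableSet_Ioi]
    have e1 : Ioi x ∩ Iic x1 = ∅ := by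
      ext z; simp only [mem_inter_iff, mem_Ioi, mem_Iic, mem_empty_iff_false]
      constructor
      · rintro ⟨h, h'⟩; linarith
      · simp
    have e2 : Ioi x ∩ Ioi x1 = Ioi x := inter_eq_left.2 (Ioi_subset_Ioi hx)
    rw [e1, e2]; simp
  refine ⟨ν, hνprob, hνint, ?_, by rw [hνE]; exact hx1m, ?_, ?_⟩
  · -- strict mean inequality
    have hshift : ∀ (p : Measure ℝ) [IsProbabilityMeasure p], Integrable (fun z : ℝ => z) p →
        ∫ z in Ioi x1, z ∂p = (∫ z in Ioi x1, (z - x1) ∂p) + x1 * p.real (Ioi x1) := by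
      intro p _ hp
      rw [integral_sub hp.integrableOn (integrable_const _)]
      simp [mul_comm]
    have hIoi : ∫ z in Ioi x1, (z - x1) ∂p ≤ ∫ z in Ioi x1, (z - x1) ∂q := by
      have hnn : ∀ (p : Measure ℝ) [IsProbabilityMeasure p], 
          0 ≤ᵐ[p.restrict (Ioi x1)] fun z => z - x1 := by
        intro p _
        filter_upwards [ae_restrict_mem measurableSet_Ioi] with z hz
        simpa using le_of_lt hz
      have hI : ∀ (p : Measure ℝ) [IsProbabilityMeasure p], Integrable (fun z : ℝ => z) p →
          Integrable (fun z => z - x1) (p.restrict (Ioi x1)) := fun p _ hp =>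
        hp.integrableOn.sub (integrable_const _)
      have hlay : ∀ (p : Measure ℝ) [IsProbabilityMeasure p],
          ∫⁻ z in Ioi x1, ENNReal.ofReal (z - x1) ∂p = ∫⁻ t in Ioi (0:ℝ), p (Ioi (t + x1)) := by
        intro p _
        rw [lintegral_eq_lintegral_meas_lt _ (hnn p) (by fun_prop)]
        refine setLIntegral_congr_fun measurableSet_Ioi fun t ht => ?_
        have : {a : ℝ | t < a - x1} = Ioi (t + x1) := by
          ext z; simp [lt_sub_iff_add_lt]
        rw [this, Measure.restrict_apply measurableSet_Ioi, inter_eq_left.2]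
        exact Ioi_subset_Ioi (by have : 0 < t := ht; linarith)
      rw [integral_eq_lintegral_of_nonneg_ae (hnn p) (hI p hp).1,
        integral_eq_lintegral_of_nonneg_ae (hnn q) (hI q hq).1]
      refine ENNReal.toReal_mono ?_ ?_
      · exact ((hI q hq).lintegral_lt_top).ne
      · rw [hlay p, hlay q]
        refine setLIntegral_mono' measurableSet_Ioi fun t ht => ?_
        have ht : 0 < t := ht
        exact (ENNReal.toReal_le_toReal (measure_ne_top _ _) (measure_ne_top _ _)).1
          (hT (t + x1) (by linarith)).le
    have hneg : ∫ z in Iic x1, z ∂p < x1 * p.real (Iic x1) := by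
      have h1 : 0 < ∫ z in Iic x1, (x1 - z) ∂p := by
        have hII : IntegrableOn (fun z => x1 - z) (Iic x1) p :=
          ((integrable_const _).sub hp).integrableOn
        rw [setIntegral_pos_iff_support_of_nonneg_ae ?_ hII]
        · have hx1' : 0 < p (Iio x1) := (ENNReal.toReal_pos_iff.1 hx1).1
          refine hx1'.trans_le (measure_mono fun z hz => ?_)
          have hz : z < x1 := hz
          exact ⟨by simpa [Function.mem_support, sub_eq_zero] using hz.ne', hz.le⟩
        · filter_upwards [ae_restrict_mem measurableSet_Iic] with z hz
          simpa using hz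
      rw [integral_sub (integrable_const _) hp.integrableOn] at h1
      simp at h1
      linarith
    rw [hνE, ← hspl p hp x1, hshift p hp, hshift q hq, hcompl p, hcompl q, ← hcp]
    nlinarith
  · intro x
    rcases le_total x1 x with h | h
    · rw [hge x h]; exact (hT x (hx1T.trans h)).le
    · rw [hcompl p, hcompl ν, hνreal _ measurableSet_Iic]
      have e1 : Iic x ∩ Iic x1 = Iic x := inter_eq_left.2 (Iic_subset_Iic.2 h)
      have e2 : Iic x ∩ Ioi x1 = ∅ := by
        ext z; simp only [mem_inter_iff, mem_Ioi, mem_Iic, mem_empty_iff_false]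
        constructor
        · rintro ⟨h, h'⟩; linarith
        · simp
      rw [e1, e2]
      simp only [measureReal_empty, add_zero]
      have : 0 ≤ p.real (Iic x) := measureReal_nonneg
      nlinarith
  · filter_upwards [eventually_ge_atTop x1] with x hx using hge x hx

/-- If `E[|U|] < ∞` and `P(U > x) = o(P(Y > x))` for a nonnegative `Y` with `E[Y] < ∞`,
then for every `μ' > E[U]` there is a real random variable `Z` (given here by its law `ν`)
with `E[U] < E[Z] < μ'`, `P(Z > x) ≥ P(U > x)` for all `x`, and
`P(Z > x) = l̃(x) P(Y > x)` for all sufficiently large `x`, where `l̃` is slowly varying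
with `l̃(x) → 0`. -/
theorem stmt11 {Ω : Type*} [MeasurableSpace Ω] (μ : Measure Ω) [IsProbabilityMeasure μ]
    (U Y : Ω → ℝ) (hUmeas : Measurable U) (hYmeas : Measurable Y)
    (hUint : Integrable U μ)
    (hY0 : ∀ ω, 0 ≤ Y ω) (hYint : Integrable Y μ)
    (ho : (fun x => tailP μ U x) =o[atTop] fun x => tailP μ Y x) :
    ∀ μ' > (∫ ω, U ω ∂μ), ∃ ν : Measure ℝ, IsProbabilityMeasure ν ∧
      Integrable (fun z : ℝ => z) ν ∧
      ((∫ ω, U ω ∂μ) < ∫ z : ℝ, z ∂ν) ∧ ((∫ z : ℝ, z ∂ν) < μ') ∧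
      (∀ x : ℝ, tailP μ U x ≤ (ν (Set.Ioi x)).toReal) ∧
      ∃ l : ℝ → ℝ, SlowlyVarying l ∧ Tendsto l atTop (nhds 0) ∧
        ∀ᶠ x in atTop, (ν (Set.Ioi x)).toReal = l x * tailP μ Y x := by
  intro m hm
  obtain ⟨l, hl1, hl2, hlpos, hl3, V, hV, hV0, hVt⟩ := exists_slow _ ho.tendsto_div_nhds_zero
  have hlaw : ∀ X : Ω → ℝ, Measurable X → ∀ x, (μ.map X).real (Ioi x) = tailP μ X x := by
    intro X hX x
    rw [map_measureReal_apply hX measurableSet_Ioi]; rfl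
  by_cases hpos : ∀ x, 0 < tailP μ Y x
  · let P : Measure (Ω × ℝ) := μ.prod (volume.restrict (Ioc (0:ℝ) 1))
    have hprob1 : IsProbabilityMeasure (volume.restrict (Ioc (0:ℝ) 1)) := ⟨by simp⟩
    let W : Ω × ℝ → ℝ := fun w => min (Y w.1) (V w.2)
    have hW : Measurable W := (hYmeas.comp measurable_fst).min (hV.comp measurable_snd)
    have hWint : Integrable W P := by
      refine (hYint.comp_fst (volume.restrict (Ioc (0:ℝ) 1))).mono' hW.aestronglyMeasurable ?_
      refine Eventually.of_forall fun w => ?_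
      rw [Real.norm_eq_abs, abs_of_nonneg (le_min (hY0 _) (hV0 _))]
      exact min_le_left _ _
    have hp : IsProbabilityMeasure (μ.map U) := Measure.isProbabilityMeasure_map hUmeas.aemeasurable
    have hq : IsProbabilityMeasure (P.map W) := Measure.isProbabilityMeasure_map hW.aemeasurable
    have hqt : ∀ x, (P.map W).real (Ioi x) = l x * tailP μ Y x := by
      intro x
      rw [map_measureReal_apply hW measurableSet_Ioi]
      have : W ⁻¹' (Ioi x) = {ω | x < Y ω} ×ˢ {u | x < V u} := by
        ext w; simp [W]
      rw [this, measureReal_def, Measure.prod_prod, hVt, ENNReal.toReal_mul,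
        ENNReal.toReal_ofReal (hlpos x).le, mul_comm]
      rfl
    have hmU : ∫ z, z ∂(μ.map U) = ∫ ω, U ω ∂μ :=
      integral_map hUmeas.aemeasurable measurable_id.aestronglyMeasurable
    obtain ⟨ν, h1, h2, h3, h4, h5, h6⟩ := splice (μ.map U) (P.map W)
      ((integrable_map_measure measurable_id.aestronglyMeasurable hUmeas.aemeasurable).2 hUint)
      ((integrable_map_measure measurable_id.aestronglyMeasurable hW.aemeasurable).2 hWint)
      (by
        filter_upwards [hl3] with x hx
        rw [hlaw U hUmeas, hqt]
        exact (div_lt_iff₀ (hpos x)).1 hx) m (by rw [hmU]; exact hm)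
    rw [hmU] at h3
    refine ⟨ν, h1, h2, h3, h4, fun x => ?_, l, hl1, hl2, ?_⟩
    · rw [← hlaw U hUmeas]; exact h5 x
    · filter_upwards [h6] with x hx
      rw [← hqt]; exact hx
  · push Not at hpos
    obtain ⟨x0, hx0⟩ := hpos
    have hYz : ∀ x ≥ x0, tailP μ Y x = 0 := by
      intro x hx
      refine le_antisymm (le_trans ?_ hx0) ENNReal.toReal_nonneg
      exact measureReal_mono (fun ω hω => lt_of_le_of_lt hx hω)
    have hUz : ∀ᶠ x in atTop, tailP μ U x = 0 := by
      filter_upwards [ho.bound one_pos, eventually_ge_atTop x0] with x hx hx'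
      rw [hYz x hx'] at hx
      simpa using hx
    let δ : ℝ := (m - ∫ ω, U ω ∂μ) / 2
    have hδ : 0 < δ := by simp only [δ]; linarith
    have hm' : Measurable fun ω => U ω + δ := hUmeas.add_const δ
    have hi' : Integrable (fun ω => U ω + δ) μ := hUint.add (integrable_const δ)
    have hE : ∫ z, z ∂(μ.map fun ω => U ω + δ) = ∫ ω, U ω ∂μ + δ := by
      rw [integral_map (f := fun z : ℝ => z) hm'.aemeasurable measurable_id.aestronglyMeasurable,
        integral_add hUint (integrable_const δ)]
      simp
    refine ⟨μ.map fun ω => U ω + δ, Measure.isProbabilityMeasure_map hm'.aemeasurable,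
      (integrable_map_measure measurable_id.aestronglyMeasurable hm'.aemeasurable).2 hi',
      by rw [hE]; linarith, by rw [hE]; simp only [δ]; linarith, fun x => ?_, l, hl1, hl2, ?_⟩
    · rw [← measureReal_def, hlaw _ hm']
      refine measureReal_mono (fun ω hω => ?_)
      have : x < U ω := hω
      show x < U ω + δ
      linarith
    · have h1 : Tendsto (fun x : ℝ => x - δ) atTop atTop := tendsto_atTop_add_const_right _ _ tendsto_id
      filter_upwards [h1.eventually hUz, eventually_ge_atTop x0] with x hx hx'
      rw [hYz x hx', mul_zero, ← measureReal_def, hlaw _ hm', ← hx]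
      simp only [tailP, sub_lt_iff_lt_add]
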